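/- Let a ∈ ℝ^N have both positive and negative entries, with M = max(a_1, …, a_N) > 0 and m = min(a_1, …, a_N) < 0. Let X, Y ∈ ℝ^N be orthonormal with respect to the Euclidean inner product and let λ, μ ∈ ℝ satisfy λ² + μ² = 1. Define κ = −λ² Σ_{i=1}^N a_i² Y_i² − μ² Σ_{1 ≤ i < j ≤ N} a_i a_j ( X_i Y_j − X_j Y_i )². Then −max(M², m²) ≤ κ ≤ −M m. -/

import Mathlib

/-- **Lagrange's identity**, as a sum over pairs `i < j`. -/
theorem sum_lt_sq_minors {ι : Type*} [Fintype ι] [LinearOrder ι] (X Y : ι → ℝ) :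
    ∑ p ∈ Finset.univ.filter (fun p : ι × ι => p.1 < p.2),
        (X p.1 * Y p.2 - X p.2 * Y p.1) ^ 2 =
      (∑ i, X i ^ 2) * (∑ i, Y i ^ 2) - (∑ i, X i * Y i) ^ 2 := by
  have hswap : ∑ p ∈ Finset.univ.filter (fun p : ι × ι => p.2 < p.1),
      (X p.1 * Y p.2 - X p.2 * Y p.1) ^ 2 =
      ∑ p ∈ Finset.univ.filter (fun p : ι × ι => p.1 < p.2),
        (X p.1 * Y p.2 - X p.2 * Y p.1) ^ 2 :=
    Finset.sum_equiv (Equiv.prodComm ι ι) (by simp) (fun p _ => by simp; ring)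
  have hsplit : ∑ p : ι × ι, (X p.1 * Y p.2 - X p.2 * Y p.1) ^ 2 =
      (∑ p ∈ Finset.univ.filter (fun p : ι × ι => p.1 < p.2),
        (X p.1 * Y p.2 - X p.2 * Y p.1) ^ 2) +
      ∑ p ∈ Finset.univ.filter (fun p : ι × ι => p.2 < p.1),
        (X p.1 * Y p.2 - X p.2 * Y p.1) ^ 2 := by
    rw [Finset.sum_filter, Finset.sum_filter, ← Finset.sum_add_distrib]
    refine Finset.sum_congr rfl fun p _ => ?_
    rcases lt_trichotomy p.1 p.2 with h | h | h
    · simp [h, h.not_gt]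
    · simp [h]
    · simp [h, h.not_gt]
  have hfull : ∑ p : ι × ι, (X p.1 * Y p.2 - X p.2 * Y p.1) ^ 2 =
      2 * ((∑ i, X i ^ 2) * (∑ i, Y i ^ 2) - (∑ i, X i * Y i) ^ 2) := by
    have hexp : ∀ p : ι × ι, (X p.1 * Y p.2 - X p.2 * Y p.1) ^ 2 =
        X p.1 ^ 2 * Y p.2 ^ 2 + Y p.1 ^ 2 * X p.2 ^ 2 -
          2 * ((X p.1 * Y p.1) * (X p.2 * Y p.2)) := fun p => by ring
    simp_rw [hexp]
    rw [Finset.sum_sub_distrib, Finset.sum_add_distrib, ← Finset.mul_sum]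
    simp_rw [Fintype.sum_prod_type, ← Finset.sum_mul_sum]
    ring
  linarith

/-- The square of a point of `[m, M]` is at most the larger square of the endpoints. -/
theorem sq_le_max_sq {x m M : ℝ} (hm : m ≤ x) (hM : x ≤ M) : x ^ 2 ≤ max (M ^ 2) (m ^ 2) := by
  rcases le_total 0 x with h | h
  · exact le_max_of_le_left (by nlinarith)
  · exact le_max_of_le_right (by nlinarith)

/-- For `m ≤ 0 ≤ M`, products of two points of `[m, M]` are at least `M * m`. -/
theorem mul_endpoints_le {x y m M : ℝ} (hm0 : m ≤ 0) (hM0 : 0 ≤ M) (hxm : m ≤ x) (hxM : x ≤ M)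
    (hym : m ≤ y) (hyM : y ≤ M) : M * m ≤ x * y := by
  rcases le_total 0 x with hx | hx <;> rcases le_total 0 y with hy | hy <;> nlinarith

/-- **Curvature bounds, indefinite case.** Let `a ∈ ℝ^N` have both positive and negative
entries, with maximum `M > 0` and minimum `m < 0`, let `X, Y ∈ ℝ^N` be orthonormal, and let
`λ² + μ² = 1`. Then the sectional curvature
`κ = −λ² ∑ aᵢ² Yᵢ² − μ² ∑_{i<j} aᵢ aⱼ (Xᵢ Yⱼ − Xⱼ Yᵢ)²` satisfies
`−max(M², m²) ≤ κ ≤ −M m`. -/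
theorem curvature_bounds_mixed_case {N : ℕ} (a X Y : Fin N → ℝ) (M m : ℝ)
    (hpos : ∃ i, 0 < a i) (hneg : ∃ i, a i < 0)
    (hM : IsGreatest (Set.range a) M) (hm : IsLeast (Set.range a) m)
    (hMpos : 0 < M) (hmneg : m < 0)
    (hX : ∑ i, X i ^ 2 = 1) (hY : ∑ i, Y i ^ 2 = 1) (hXY : ∑ i, X i * Y i = 0)
    (lam mu : ℝ) (hlm : lam ^ 2 + mu ^ 2 = 1) :
    -max (M ^ 2) (m ^ 2) ≤ -(lam ^ 2) * (∑ i, (a i) ^ 2 * Y i ^ 2) -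
        mu ^ 2 * ∑ p ∈ Finset.univ.filter (fun p : Fin N × Fin N => p.1 < p.2),
          a p.1 * a p.2 * (X p.1 * Y p.2 - X p.2 * Y p.1) ^ 2 ∧
      -(lam ^ 2) * (∑ i, (a i) ^ 2 * Y i ^ 2) -
        mu ^ 2 * ∑ p ∈ Finset.univ.filter (fun p : Fin N × Fin N => p.1 < p.2),
          a p.1 * a p.2 * (X p.1 * Y p.2 - X p.2 * Y p.1) ^ 2 ≤ -(M * m) := by
  have hle : ∀ i, a i ≤ M := fun i => hM.2 ⟨i, rfl⟩
  have hge : ∀ i, m ≤ a i := fun i => hm.2 ⟨i, rfl⟩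
  have hsq : ∀ i, a i ^ 2 ≤ max (M ^ 2) (m ^ 2) := fun i => sq_le_max_sq (hge i) (hle i)
  have hw := sum_lt_sq_minors X Y
  rw [hX, hY, hXY] at hw
  have hA0 : 0 ≤ ∑ i, a i ^ 2 * Y i ^ 2 := Finset.sum_nonneg fun i _ => by positivity
  have hA : ∑ i, a i ^ 2 * Y i ^ 2 ≤ max (M ^ 2) (m ^ 2) := by
    calc ∑ i, a i ^ 2 * Y i ^ 2 ≤ ∑ i, max (M ^ 2) (m ^ 2) * Y i ^ 2 :=
          Finset.sum_le_sum fun i _ => mul_le_mul_of_nonneg_right (hsq i) (sq_nonneg _)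
      _ = max (M ^ 2) (m ^ 2) := by rw [← Finset.mul_sum, hY, mul_one]
  set P := Finset.univ.filter (fun p : Fin N × Fin N => p.1 < p.2)
  have hB : ∑ p ∈ P, a p.1 * a p.2 * (X p.1 * Y p.2 - X p.2 * Y p.1) ^ 2 ≤
      max (M ^ 2) (m ^ 2) := by
    calc _ ≤ ∑ p ∈ P, max (M ^ 2) (m ^ 2) * (X p.1 * Y p.2 - X p.2 * Y p.1) ^ 2 :=
          Finset.sum_le_sum fun p _ => mul_le_mul_of_nonneg_right
            (by nlinarith [hsq p.1, hsq p.2, sq_nonneg (a p.1 - a p.2)]) (sq_nonneg _)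
      _ = max (M ^ 2) (m ^ 2) := by rw [← Finset.mul_sum, hw]; ring
  have hB' : M * m ≤ ∑ p ∈ P, a p.1 * a p.2 * (X p.1 * Y p.2 - X p.2 * Y p.1) ^ 2 := by
    calc M * m = ∑ p ∈ P, M * m * (X p.1 * Y p.2 - X p.2 * Y p.1) ^ 2 := by
          rw [← Finset.mul_sum, hw]; ring
      _ ≤ _ := Finset.sum_le_sum fun p _ => mul_le_mul_of_nonneg_right
          (mul_endpoints_le hmneg.le hMpos.le (hge _) (hle _) (hge _) (hle _)) (sq_nonneg _)
  have hl := sq_nonneg lam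
  have hu := sq_nonneg mu
  have hMm : M * m ≤ 0 := (mul_neg_of_pos_of_neg hMpos hmneg).le
  constructor
  · linear_combination mul_le_mul_of_nonneg_left hA hl + mul_le_mul_of_nonneg_left hB hu +
      max (M ^ 2) (m ^ 2) * hlm
  · linear_combination mul_nonneg hl hA0 + mul_le_mul_of_nonneg_left hB' hu +
      mul_le_mul_of_nonneg_left hMm hl - M * m * hlm
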